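/- Let r > 0. For integers d ≥ 2 define a(d,n) = (k(d,n) + (d−1)/2)^{−r} and, for ε ∈ (0,1), the normalized-error information complexity n(ε,d) = min{n ∈ ℕ : a(d,n+1) ≤ ε·((d−1)/2)^{−r}}. Then there exists ε₀ ∈ (0,1) such that for all ε ∈ (0, ε₀] and all integers d ≥ 2 one has n(ε,d) ≥ 2^d. In particular, the problem suffers from the curse of dimensionality for the normalized error criterion. -/

import Mathlib

/-- `C(d,k) = (2k+d)·(k+d−1)!/(k!·d!)`, the dimension of the space of spherical
polynomials of degree at most `k` on the sphere `S^d`, as a real number. -/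
noncomputable def sphC (d k : ℕ) : ℝ :=
  ((2 * k + d : ℕ) : ℝ) * (Nat.factorial (k + d - 1) : ℝ) /
    ((Nat.factorial k : ℝ) * (Nat.factorial d : ℝ))

/-- The approximation numbers `a(d,n) = (k(d,n) + (d−1)/2)^{−r}` of
`I_d : H^{r,−}(S^d) → L₂(S^d)`, via an index function `kf` with `kf d n = k(d,n)`. -/
noncomputable def aMinus (r : ℝ) (d : ℕ) (kf : ℕ → ℕ → ℕ) (n : ℕ) : ℝ :=
  ((kf d n : ℝ) + ((d : ℝ) - 1) / 2) ^ (-r)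

/-- The normalized-error information complexity
`n(ε,d) = min{n ∈ ℕ : a(d,n+1) ≤ ε·((d−1)/2)^{−r}}` of the approximation problem
`I_d : H^{r,−}(S^d) → L₂(S^d)`; its initial error is `a(d,1) = ((d−1)/2)^{−r}`. -/
noncomputable def infoComplexityNor (r : ℝ) (d : ℕ) (kf : ℕ → ℕ → ℕ) (ε : ℝ) : ℕ :=
  sInf {n : ℕ | aMinus r d kf (n + 1) ≤ ε * (((d : ℝ) - 1) / 2) ^ (-r)}

theorem two_pow_le_centralBinom (n : ℕ) : 2 ^ n ≤ n.centralBinom := by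
  induction n with
  | zero => simp
  | succ n ih =>
    have h := Nat.succ_mul_centralBinom_succ n
    refine Nat.le_of_mul_le_mul_left (c := n + 1) ?_ n.succ_pos
    rw [h, pow_succ]
    nlinarith [Nat.zero_le (n * n.centralBinom), Nat.mul_le_mul_left (n + 1) ih]

theorem choose_le_sphC {d : ℕ} (hd : 1 ≤ d) (k : ℕ) :
    ((k + d).choose d : ℝ) ≤ sphC d k := by
  obtain ⟨m, rfl⟩ : ∃ m, d = m + 1 := ⟨d - 1, by omega⟩
  rw [sphC, le_div_iff₀ (by positivity)]
  have hle : (k + (m + 1)).choose (m + 1) * (k.factorial * (m + 1).factorial) ≤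
      (2 * k + (m + 1)) * (k + (m + 1) - 1).factorial := by
    rw [← mul_assoc, Nat.add_choose_mul_factorial_mul_factorial]
    rw [show k + (m + 1) = (k + m) + 1 by omega, Nat.factorial_succ, Nat.add_sub_cancel]
    exact Nat.mul_le_mul_right _ (by omega)
  exact_mod_cast hle

theorem two_pow_le_sphC {d k : ℕ} (hd : 1 ≤ d) (hk : d ≤ k) : (2 : ℝ) ^ d ≤ sphC d k := by
  refine le_trans ?_ (choose_le_sphC hd k)
  have h : 2 ^ d ≤ (k + d).choose d :=
    (two_pow_le_centralBinom d).trans (Nat.choose_le_choose d (by omega))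
  exact_mod_cast h

theorem sphC_nonneg (d k : ℕ) : 0 ≤ sphC d k := by
  unfold sphC
  positivity

/-- An index function bounded below by the inverse of `sphC d` takes arbitrarily large values. -/
theorem exists_le_of_le_sphC {d : ℕ} {κ : ℕ → ℕ}
    (hκ : ∀ n : ℕ, 1 ≤ n → (n : ℝ) ≤ sphC d (κ n)) (K : ℕ) : ∃ n : ℕ, K ≤ κ (n + 1) := by
  obtain ⟨n, hn⟩ := exists_nat_gt (∑ j ∈ Finset.range K, sphC d j)
  refine ⟨n, ?_⟩
  by_contra! hlt
  have h₁ := Finset.single_le_sum (f := sphC d) (fun j _ => sphC_nonneg d j)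
    (Finset.mem_range.2 hlt)
  have h₂ := hκ (n + 1) n.succ_pos
  push_cast at h₂
  linarith

/-- Theorem 5.1(2): for the normalized error criterion, the approximation problem
`I_d : H^{r,−}(S^d) → L₂(S^d)` suffers from the curse of dimensionality: there is
`ε₀ ∈ (0,1)` such that `n(ε,d) ≥ 2^d` for all `0 < ε ≤ ε₀` and all `d ≥ 2`. -/
theorem sobolev_minus_sphere_curse
    (r : ℝ) (hr : 0 < r)
    (kf : ℕ → ℕ → ℕ)
    (hkf : ∀ d : ℕ, 2 ≤ d → ∀ n : ℕ, 1 ≤ n →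
      (n : ℝ) ≤ sphC d (kf d n) ∧ (0 < kf d n → sphC d (kf d n - 1) < (n : ℝ))) :
    ∃ ε₀ : ℝ, 0 < ε₀ ∧ ε₀ < 1 ∧
      ∀ ε : ℝ, 0 < ε → ε ≤ ε₀ → ∀ d : ℕ, 2 ≤ d →
        2 ^ d ≤ infoComplexityNor r d kf ε := by
  refine ⟨(7 : ℝ) ^ (-r), by positivity,
    Real.rpow_lt_one_of_one_lt_of_neg (by norm_num) (by linarith), ?_⟩
  intro ε hε hε₀ d hd
  have hd' : (2 : ℝ) ≤ d := by exact_mod_cast hd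
  have hh : 0 < ((d : ℝ) - 1) / 2 := by linarith
  refine le_csInf ?_ ?_
  · have ht := (tendsto_rpow_neg_atTop hr).eventually
      (Iic_mem_nhds (show 0 < ε * (((d : ℝ) - 1) / 2) ^ (-r) by positivity))
    obtain ⟨x, hx⟩ := Filter.eventually_atTop.1 ht
    obtain ⟨K, hK⟩ := exists_nat_ge x
    obtain ⟨n, hn⟩ := exists_le_of_le_sphC (fun n hn => (hkf d hd n hn).1) K
    have hn' : (K : ℝ) ≤ kf d (n + 1) := by exact_mod_cast hn
    exact ⟨n, hx _ (by linarith)⟩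
  · intro n hn
    have hle : ((kf d (n + 1) : ℝ) + ((d : ℝ) - 1) / 2) ^ (-r) ≤
        (7 * (((d : ℝ) - 1) / 2)) ^ (-r) := by
      rw [Real.mul_rpow (by norm_num) hh.le]
      exact le_trans hn (mul_le_mul_of_nonneg_right hε₀ (by positivity))
    rw [Real.rpow_le_rpow_iff_of_neg (by positivity) (by positivity) (by linarith)] at hle
    have hk : d + 1 ≤ kf d (n + 1) := by
      have : (d : ℝ) + 1 ≤ kf d (n + 1) := by linarith
      exact_mod_cast this
    have hlt := (two_pow_le_sphC (by omega) (by omega)).trans_lt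
      ((hkf d hd (n + 1) n.succ_pos).2 (by omega))
    exact Nat.lt_succ_iff.1 (by exact_mod_cast hlt)
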